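/- Let stars S₁(V₁,E₁) and S₂(V₂,E₂) of a star decomposition of a cyclic polygon form a double star with common diagonal e = u₁u₂, and let (v₁,v₂) with v₁ ∈ V₁ and v₂ ∈ V₂ be a linkable pair. Then there exist stars S₁'(V₁',E₁') and S₂'(V₂',E₂') forming a double star with common diagonal v₁v₂ such that V₁' ∪ V₂' = V₁ ∪ V₂ and E₁' ∪ E₂' = ((E₁ ∪ E₂) \ {u₁u₂, u₂u₁}) ∪ {v₁v₂, v₂v₁}. -/

import Mathlib

open Complex
open scoped Classical

noncomputable section

/-- The anticlockwise arc displacement from `u` to `v` on the unit circle, lying in `(0, 2π]`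
(equal to `2π` when `v = u`). -/
def posArc (u v : ℂ) : ℝ :=
  if 0 < Complex.arg (v / u) then Complex.arg (v / u) else Complex.arg (v / u) + 2 * Real.pi

/-- `u, v, w` occur in anticlockwise order on the circle. -/
def ACW (u v w : ℂ) : Prop :=
  u ≠ v ∧ v ≠ w ∧ u ≠ w ∧ posArc u v < posArc u w

/-- The open anticlockwise arc from `u` to `v`. -/
def arcOO (u v : ℂ) : Set ℂ := {x | x ≠ u ∧ x ≠ v ∧ posArc u x < posArc u v}

/-- The anticlockwise arc from `u` to `v`, open at `u` and closed at `v`. -/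
def arcOC (u v : ℂ) : Set ℂ := {x | x ≠ u ∧ (x = v ∨ posArc u x < posArc u v)}

/-- The closed anticlockwise arc from `u` to `v`. -/
def arcCC (u v : ℂ) : Set ℂ := {x | x = u ∨ x = v ∨ (x ≠ u ∧ posArc u x < posArc u v)}

/-- The (undirected) angle `∠ x v z` at apex `v`. -/
def vangle (x v z : ℂ) : ℝ := |Complex.arg ((x - v) / (z - v))|

/-- A cyclic polygon: a finite set of vertices on the unit circle together with a set of
directed edges such that every vertex has indegree and outdegree one, and any two
consecutive edges `uv`, `vw` have `u, v, w` in anticlockwise order. -/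
structure CyclicPolygon where
  V : Finset ℂ
  E : Finset (ℂ × ℂ)
  nonempty : V.Nonempty
  onCircle : ∀ v ∈ V, ‖v‖ = 1
  endmem : ∀ e ∈ E, e.1 ∈ V ∧ e.2 ∈ V
  outdeg : ∀ v ∈ V, ∃! w, (v, w) ∈ E
  indeg : ∀ v ∈ V, ∃! u, (u, v) ∈ E
  acw : ∀ u v w : ℂ, (u, v) ∈ E → (v, w) ∈ E → ACW u v w

namespace CyclicPolygon

/-- The successor `v⁺` of a vertex. -/
noncomputable def next (P : CyclicPolygon) (v : ℂ) : ℂ :=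
  if h : ∃ w, (v, w) ∈ P.E then h.choose else v

/-- The predecessor `v⁻` of a vertex. -/
noncomputable def prev (P : CyclicPolygon) (v : ℂ) : ℂ :=
  if h : ∃ u, (u, v) ∈ P.E then h.choose else v

end CyclicPolygon

/-- The interior angle `∠ v⁻ v v⁺` of `P` at `v`. -/
def interiorAngle (P : CyclicPolygon) (v : ℂ) : ℝ :=
  vangle (P.prev v) v (P.next v)

/-- The length of an edge `uv`: the number of vertices on the open anticlockwise
arc from `u` to `v`, plus one. -/
def edgeLength (P : CyclicPolygon) (u v : ℂ) : ℕ :=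
  ((P.V : Set ℂ) ∩ arcOO u v).ncard + 1

/-- A `k`-star: a cyclic polygon with `2k+1` vertices all of whose edges have length `k`. -/
def IsKStar (S : CyclicPolygon) (k : ℕ) : Prop :=
  S.V.card = 2 * k + 1 ∧ ∀ e ∈ S.E, edgeLength S e.1 e.2 = k

/-- A star: a `k`-star for some positive integer `k`. -/
def IsStar (S : CyclicPolygon) : Prop := ∃ k : ℕ, 0 < k ∧ IsKStar S k

/-- The segment from `u` to `x` splits the interior angle `∠ u⁻ u u⁺` of `S` at `u`
into the two (smaller, nonzero) angles `∠ u⁻ u x` and `∠ x u u⁺`. -/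
def SplitsVertexAngle (S : CyclicPolygon) (u x : ℂ) : Prop :=
  u ∈ S.V ∧ 0 < vangle (S.prev u) u x ∧ 0 < vangle x u (S.next u) ∧
    vangle (S.prev u) u x + vangle x u (S.next u) = vangle (S.prev u) u (S.next u)

/-- `(u, v)` is a linkable pair for the pair of cyclic polygons `(S₁, S₂)`:
the segment `uv` splits the angle of `S₁` at `u` and the angle of `S₂` at `v`. -/
def LinkablePair (S₁ S₂ : CyclicPolygon) (u v : ℂ) : Prop :=
  u ≠ v ∧ SplitsVertexAngle S₁ u v ∧ SplitsVertexAngle S₂ v u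

/-- `u, v` is a linkable pair of vertices of the cyclic polygon `P`. -/
def Linkable (P : CyclicPolygon) (u v : ℂ) : Prop := LinkablePair P P u v

/-- `D` is a set of (undirected) diagonals of `P`, i.e. every member joins a linkable pair. -/
def IsDiagonalSet (P : CyclicPolygon) (D : Set (Sym2 ℂ)) : Prop :=
  ∀ u v : ℂ, s(u, v) ∈ D → Linkable P u v

/-- The set `D̃` of directed edges associated to a set of diagonals `D`. -/
def tilde (D : Set (Sym2 ℂ)) : Set (ℂ × ℂ) := {e | s(e.1, e.2) ∈ D}

/-- The segment from `v` towards `x` splits the angle `∠ u v w`. -/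
def SplitsAngle3 (u v w x : ℂ) : Prop :=
  0 < vangle u v x ∧ 0 < vangle x v w ∧ vangle u v x + vangle x v w = vangle u v w

/-- `𝒮` is a star decomposition of `P` with respect to the diagonal set `D`: the
cycle decomposition of `E ∪ D̃` determined by `f_next` (each cycle follows the
tightest turn, i.e. no diagonal of `D` splits the angle between two consecutive
edges of a cycle), all of whose cycles are stars. -/
def IsStarDecomp (P : CyclicPolygon) (D : Set (Sym2 ℂ)) (𝒮 : Finset CyclicPolygon) : Prop :=
  IsDiagonalSet P D ∧
  (∀ S ∈ 𝒮, IsStar S ∧ (S.V : Set ℂ) ⊆ (P.V : Set ℂ)) ∧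
  (∀ S ∈ 𝒮, (S.E : Set (ℂ × ℂ)) ⊆ (P.E : Set (ℂ × ℂ)) ∪ tilde D) ∧
  (∀ e ∈ (P.E : Set (ℂ × ℂ)) ∪ tilde D, ∃ S ∈ 𝒮, e ∈ S.E) ∧
  (∀ S₁ ∈ 𝒮, ∀ S₂ ∈ 𝒮, S₁ ≠ S₂ → ∀ e : ℂ × ℂ, e ∈ S₁.E → e ∉ S₂.E) ∧
  (∀ S ∈ 𝒮, ∀ u v w : ℂ, (u, v) ∈ S.E → (v, w) ∈ S.E →
      ¬ ∃ x, s(v, x) ∈ D ∧ SplitsAngle3 u v w x)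

/-- `P` admits a star decomposition with respect to `D`. -/
def HasStarDecomp (P : CyclicPolygon) (D : Set (Sym2 ℂ)) : Prop :=
  ∃ 𝒮 : Finset CyclicPolygon, IsStarDecomp P D 𝒮

/-- A maximal star decomposition: no proper superset of `D` admits a star decomposition. -/
def IsMaximalStarDecomp (P : CyclicPolygon) (D : Set (Sym2 ℂ))
    (𝒮 : Finset CyclicPolygon) : Prop :=
  IsStarDecomp P D 𝒮 ∧ ∀ D' : Set (Sym2 ℂ), D ⊂ D' → ¬ HasStarDecomp P D'

/-- `D'` is obtained from `D` by a diagonal flip: remove one diagonal and add another. -/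
def FlipStep (D D' : Set (Sym2 ℂ)) : Prop :=
  ∃ e f : Sym2 ℂ, e ∈ D ∧ f ∉ D ∧ D' = (D \ {e}) ∪ {f}

/-- The two chords `ab` and `cd` are crossing: they share no endpoint and
intersect inside the circle. -/
def Crossing (a b c d : ℂ) : Prop :=
  a ≠ c ∧ a ≠ d ∧ b ≠ c ∧ b ≠ d ∧ (openSegment ℝ a b ∩ openSegment ℝ c d).Nonempty

/-- The two chords `ab` and `cd` share a common point: they have a common
endvertex or intersect inside the circle. -/
def ShareCommonPoint (a b c d : ℂ) : Prop :=
  a = c ∨ a = d ∨ b = c ∨ b = d ∨ (openSegment ℝ a b ∩ openSegment ℝ c d).Nonempty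

/-- Two cyclic polygons have a pair of overlapped angles: a common vertex `y` and a vertex
`x` of either polygon lying on both arcs `⦅y⁺ y⁻⟧` (taken in each polygon). -/
def OverlappedAngles (S₁ S₂ : CyclicPolygon) : Prop :=
  ∃ y : ℂ, y ∈ S₁.V ∧ y ∈ S₂.V ∧
    ∃ x : ℂ, (x ∈ S₁.V ∨ x ∈ S₂.V) ∧
      x ∈ arcOC (S₁.next y) (S₁.prev y) ∧ x ∈ arcOC (S₂.next y) (S₂.prev y)

/-- Two cyclic polygons are mutually independent: no two of their angles are overlapped. -/
def IndepPolygons (S₁ S₂ : CyclicPolygon) : Prop := ¬ OverlappedAngles S₁ S₂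

/-- The edge `uv` of `P` is minimal: no edge `xy` of `P` has all vertices of the closed
arc from `x` to `y` inside the open arc from `u` to `v`. -/
def MinimalEdge (P : CyclicPolygon) (u v : ℂ) : Prop :=
  (u, v) ∈ P.E ∧
    ¬ ∃ x y : ℂ, (x, y) ∈ P.E ∧ ∀ z ∈ P.V, z ∈ arcCC x y → z ∈ arcOO u v

/-- `vs` enumerates the star `S` as `v₀ v₁ ⋯ v₂ₖ` with `v₁ = v`, `v₀ = v⁻` (so that `v⁻v`
is an edge of `S`), each edge of `S` is an edge of `P` or a diagonal of `P`, and all the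
edges `v₂ᵢ₋₁v₂ᵢ` are edges of `P`. -/
def IsBorderCandidate (P : CyclicPolygon) (v : ℂ) (S : CyclicPolygon) (k : ℕ)
    (vs : ℕ → ℂ) : Prop :=
  0 < k ∧ IsStar S ∧ S.V.card = 2 * k + 1 ∧
  (S.V : Set ℂ) ⊆ (P.V : Set ℂ) ∧
  vs 0 = P.prev v ∧ vs 1 = v ∧ vs (2 * k + 1) = vs 0 ∧
  (∀ x ∈ S.V, ∃ i ≤ 2 * k, vs i = x) ∧
  (∀ i ≤ 2 * k, (vs i, vs (i + 1)) ∈ S.E) ∧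
  (∀ i ≤ 2 * k, (vs i, vs (i + 1)) ∈ P.E ∨ Linkable P (vs i) (vs (i + 1))) ∧
  (∀ i : ℕ, 1 ≤ i → i ≤ k → (vs (2 * i - 1), vs (2 * i)) ∈ P.E)

/-- The angle sequence `(∠v₁v₂v₃, ∠v₃v₄v₅, …, ∠v₂ₖ₋₁v₂ₖv₀)` of an enumerated star. -/
noncomputable def angleList (vs : ℕ → ℂ) (k : ℕ) : List ℝ :=
  (List.range k).map fun i => vangle (vs (2 * i + 1)) (vs (2 * i + 2)) (vs (2 * i + 3))

/-- `S` is the border star `S*(P, v)`: among all border candidates, its angle sequence is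
lexicographically minimal. -/
def IsBorderStar (P : CyclicPolygon) (v : ℂ) (S : CyclicPolygon) : Prop :=
  ∃ (k : ℕ) (vs : ℕ → ℂ), IsBorderCandidate P v S k vs ∧
    ∀ (S' : CyclicPolygon) (k' : ℕ) (vs' : ℕ → ℂ), IsBorderCandidate P v S' k' vs' →
      ¬ List.Lex (· < ·) (angleList vs' k') (angleList vs k)


theorem posArc_pos (u v : ℂ) : 0 < posArc u v := by
  unfold posArc
  have h1 := Complex.neg_pi_lt_arg (v / u)
  have := Real.pi_pos
  split_ifs with h
  · exact h
  · linarith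

theorem posArc_le (u v : ℂ) : posArc u v ≤ 2 * Real.pi := by
  unfold posArc
  have h1 := Complex.arg_le_pi (v / u)
  have := Real.pi_pos
  split_ifs with h <;> linarith

theorem exp_posArc {u v : ℂ} (hu : ‖u‖ = 1) (hv : ‖v‖ = 1) :
    u * Complex.exp (posArc u v * I) = v := by
  have hu0 : u ≠ 0 := by
    intro h
    simp [h] at hu
  have h1 : Complex.exp (Complex.arg (v / u) * I) = v / u := by
    have h2 := Complex.norm_mul_exp_arg_mul_I (v / u)
    have h3 : ‖v / u‖ = 1 := by rw [norm_div, hu, hv, div_one]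
    rw [h3] at h2
    simpa using h2
  have h4 : Complex.exp (posArc u v * I) = v / u := by
    unfold posArc
    split_ifs with h
    · exact h1
    · push_cast
      rw [add_mul, Complex.exp_add, Complex.exp_two_pi_mul_I, mul_one, h1]
  rw [h4]
  field_simp

theorem posArc_eq_of {u v : ℂ} (hu : ‖u‖ = 1) (hv : ‖v‖ = 1) {s : ℝ} (h0 : 0 < s)
    (h1 : s ≤ 2 * Real.pi) (h : u * Complex.exp (s * I) = v) : posArc u v = s := by
  have hu0 : u ≠ 0 := by
    intro h
    simp [h] at hu
  have h2 := exp_posArc hu hv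
  rw [← h] at h2
  have h3 := mul_left_cancel₀ hu0 h2
  rw [h] at h3
  rw [Complex.exp_eq_exp_iff_exists_int] at h3
  obtain ⟨n, hn⟩ := h3
  have h4 : posArc u v = s + n * (2 * Real.pi) := by
    have := congrArg Complex.im hn
    simpa using this
  have ha := posArc_pos u v
  have hb := posArc_le u v
  have hpi := Real.pi_pos
  have h5 : (n : ℝ) < 1 := by nlinarith
  have h6 : (-1 : ℝ) < n := by nlinarith
  have h7 : n = 0 := by
    have h5' : n < 1 := by exact_mod_cast h5
    have h6' : -1 < n := by exact_mod_cast h6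
    omega
  rw [h4, h7]
  simp

theorem posArc_inj {x u v : ℂ} (hx : ‖x‖ = 1) (hu : ‖u‖ = 1) (hv : ‖v‖ = 1)
    (h : posArc x u = posArc x v) : u = v := by
  rw [← exp_posArc hx hu, h, exp_posArc hx hv]

theorem posArc_self {u : ℂ} (hu : ‖u‖ = 1) : posArc u u = 2 * Real.pi := by
  apply posArc_eq_of hu hu (by positivity) le_rfl
  push_cast
  rw [Complex.exp_two_pi_mul_I, mul_one]

theorem posArc_rebase {x u w : ℂ} (hx : ‖x‖ = 1) (hu : ‖u‖ = 1) (hw : ‖w‖ = 1) :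
    posArc u w = if posArc x u < posArc x w then posArc x w - posArc x u
      else posArc x w - posArc x u + 2 * Real.pi := by
  have key : u * Complex.exp ((posArc x w - posArc x u : ℝ) * I) = w := by
    have h1 := exp_posArc hx hu
    have h2 := exp_posArc hx hw
    have h3 : Complex.exp (posArc x u * I) * Complex.exp ((posArc x w - posArc x u : ℝ) * I) =
        Complex.exp (posArc x w * I) := by
      rw [← Complex.exp_add]
      congr 1
      push_cast
      ring
    calc u * Complex.exp ((posArc x w - posArc x u : ℝ) * I)
        = x * (Complex.exp (posArc x u * I) *
            Complex.exp ((posArc x w - posArc x u : ℝ) * I)) := by rw [← mul_assoc, h1]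
      _ = w := by rw [h3, h2]
  have a1 := posArc_pos x u
  have a2 := posArc_pos x w
  have a3 := posArc_le x u
  have a4 := posArc_le x w
  split_ifs with h
  · exact posArc_eq_of hu hw (by linarith) (by linarith) key
  · apply posArc_eq_of hu hw (by linarith) (by linarith)
    push_cast at key ⊢
    rw [add_mul, Complex.exp_add, Complex.exp_two_pi_mul_I, mul_one, key]

theorem exp_sub_one (a : ℝ) : Complex.exp (a * I) - 1 =
    2 * (Real.sin (a / 2) : ℂ) * I * Complex.exp ((a / 2 : ℝ) * I) := by
  have h : Complex.exp (a * I) = Complex.exp ((a / 2 : ℝ) * I) * Complex.exp ((a / 2 : ℝ) * I) := by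
    rw [← Complex.exp_add]
    congr 1
    push_cast
    ring
  have h2 : Complex.exp (-(a / 2 : ℝ) * I) * Complex.exp ((a / 2 : ℝ) * I) = 1 := by
    rw [← Complex.exp_add]
    simp
  rw [Complex.ofReal_sin, Complex.sin, h]
  linear_combination (1 : ℂ) * h2 - (Complex.exp (-(a / 2 : ℝ) * I) -
    Complex.exp ((a / 2 : ℝ) * I)) * Complex.exp ((a / 2 : ℝ) * I) * Complex.I_mul_I

theorem vangle_eq {v x z : ℂ} (hv : ‖v‖ = 1) (hx : ‖x‖ = 1) (hz : ‖z‖ = 1)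
    (hxv : x ≠ v) (hzv : z ≠ v) : vangle x v z = |posArc v x - posArc v z| / 2 := by
  have hlt : ∀ y : ℂ, ‖y‖ = 1 → y ≠ v → posArc v y < 2 * Real.pi := by
    intro y hy hyv
    refine lt_of_le_of_ne (posArc_le v y) ?_
    intro h
    apply hyv
    exact posArc_inj hv hy hv (by rw [h, posArc_self hv])
  have hv0 : v ≠ 0 := by
    intro h
    simp [h] at hv
  have a1 := posArc_pos v x
  have a2 := posArc_pos v z
  have a3 := hlt x hx hxv
  have a4 := hlt z hz hzv
  have s1 : 0 < Real.sin (posArc v x / 2) := Real.sin_pos_of_pos_of_lt_pi (by linarith) (by linarith)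
  have s2 : 0 < Real.sin (posArc v z / 2) := Real.sin_pos_of_pos_of_lt_pi (by linarith) (by linarith)
  have e1 : x - v = v * (Complex.exp (posArc v x * I) - 1) := by
    rw [mul_sub, exp_posArc hv hx, mul_one]
  have e2 : z - v = v * (Complex.exp (posArc v z * I) - 1) := by
    rw [mul_sub, exp_posArc hv hz, mul_one]
  have key : (x - v) / (z - v) =
      ((Real.sin (posArc v x / 2) / Real.sin (posArc v z / 2) : ℝ) : ℂ) *
        Complex.exp (((posArc v x - posArc v z) / 2 : ℝ) * I) := by
    rw [e1, e2, exp_sub_one, exp_sub_one, mul_div_mul_left _ _ hv0]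
    have h3 : Complex.exp (((posArc v x - posArc v z) / 2 : ℝ) * I) *
        Complex.exp ((posArc v z / 2 : ℝ) * I) = Complex.exp ((posArc v x / 2 : ℝ) * I) := by
      rw [← Complex.exp_add]
      congr 1
      push_cast
      ring
    rw [← h3]
    have s2' : (Real.sin (posArc v z / 2) : ℂ) ≠ 0 := by
      exact_mod_cast s2.ne'
    have h5 := Complex.exp_ne_zero ((posArc v z / 2 : ℝ) * I)
    have hI := Complex.I_ne_zero
    generalize Complex.exp ((posArc v z / 2 : ℝ) * I) = X at *
    generalize Complex.exp (((posArc v x - posArc v z) / 2 : ℝ) * I) = Y at *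
    rw [Complex.ofReal_div]
    generalize (Real.sin (posArc v z / 2) : ℂ) = Z at *
    field_simp
  unfold vangle
  rw [key, Complex.exp_mul_I, Complex.arg_mul_cos_add_sin_mul_I (div_pos s1 s2)
    ⟨by linarith, by linarith⟩, abs_div, abs_two]

/-- linkability puts the other endpoint strictly inside the opposite arc. -/
theorem split_arc {v x y z : ℂ} (hv : ‖v‖ = 1) (hx : ‖x‖ = 1) (hy : ‖y‖ = 1) (hz : ‖z‖ = 1)
    (hxv : x ≠ v) (hyv : y ≠ v) (hzv : z ≠ v) (hlt : posArc v z < posArc v x)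
    (h1 : 0 < vangle x v y) (h2 : 0 < vangle y v z)
    (h3 : vangle x v y + vangle y v z = vangle x v z) :
    posArc v z < posArc v y ∧ posArc v y < posArc v x := by
  rw [vangle_eq hv hx hy hxv hyv] at *
  rw [vangle_eq hv hy hz hyv hzv] at *
  rw [vangle_eq hv hx hz hxv hzv] at *
  rw [abs_of_pos (sub_pos.2 hlt)] at h3
  rcases abs_cases (posArc v x - posArc v y) with ⟨h, h'⟩ | ⟨h, h'⟩ <;>
  rcases abs_cases (posArc v y - posArc v z) with ⟨g, g'⟩ | ⟨g, g'⟩ <;>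
  constructor <;> linarith

/-- `c 0, c 1, …, c (2n) , c (2n+1) = c 0` traverses the edges of an `n`-star. -/
def SS (c : ℕ → ℂ) (n : ℕ) : Prop :=
  1 ≤ n ∧ (∀ i, ‖c i‖ = 1) ∧ c (2 * n + 1) = c 0 ∧
  (∀ i, i + 2 ≤ 2 * n → posArc (c 0) (c (i + 2)) < posArc (c 0) (c i)) ∧
  posArc (c 0) (c 1) < posArc (c 0) (c (2 * n))

/-- the rank on the circle of the `i`-th point of a star traversal. -/
def rk (n i : ℕ) : ℕ := if i % 2 = 0 then 2 * n - i / 2 else n - 1 - i / 2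

/-- inverse of `rk`. -/
def ix (n s : ℕ) : ℕ := if s < n then 2 * (n - 1 - s) + 1 else 2 * (2 * n - s)

theorem ix_le (n s : ℕ) (hn : 1 ≤ n) : ix n s ≤ 2 * n := by
  unfold ix
  split_ifs <;> omega

theorem rk_le (n i : ℕ) : rk n i ≤ 2 * n := by
  unfold rk
  split_ifs <;> omega

theorem rk_ix (n s : ℕ) (hs : s ≤ 2 * n) : rk n (ix n s) = s := by
  unfold rk ix
  split_ifs <;> omega

theorem ix_rk (n i : ℕ) (hn : 1 ≤ n) (hi : i ≤ 2 * n) : ix n (rk n i) = i := by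
  unfold rk ix
  split_ifs <;> omega

theorem SS.step {c : ℕ → ℂ} {n : ℕ} (h : SS c n) (i m : ℕ) (him : i + 2 * (m + 1) ≤ 2 * n) :
    posArc (c 0) (c (i + 2 * (m + 1))) < posArc (c 0) (c i) := by
  induction m with
  | zero => exact h.2.2.2.1 i him
  | succ m ih =>
    have h1 := ih (by omega)
    have h2 := h.2.2.2.1 (i + 2 * (m + 1)) (by omega)
    exact lt_trans h2 h1

theorem SS.step' {c : ℕ → ℂ} {n : ℕ} (h : SS c n) {i j : ℕ} (hij : i < j) (hj : j ≤ 2 * n)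
    (hp : i % 2 = j % 2) : posArc (c 0) (c j) < posArc (c 0) (c i) := by
  have := h.step i ((j - i) / 2 - 1) (by omega)
  rwa [show i + 2 * ((j - i) / 2 - 1 + 1) = j by omega] at this

theorem SS.ord {c : ℕ → ℂ} {n : ℕ} (h : SS c n) {i j : ℕ} (hi : i ≤ 2 * n) (hj : j ≤ 2 * n)
    (hij : rk n i < rk n j) : posArc (c 0) (c i) < posArc (c 0) (c j) := by
  have hn := h.1
  rcases Nat.mod_two_eq_zero_or_one i with h1 | h1 <;>
  rcases Nat.mod_two_eq_zero_or_one j with h2 | h2 <;> simp only [rk, h1, h2] at hij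
  · exact h.step' (by simp at hij; omega) hi (by omega)
  · simp at hij
    omega
  · have a1 : posArc (c 0) (c i) ≤ posArc (c 0) (c 1) := by
      rcases Nat.lt_or_ge 1 i with h3 | h3
      · exact (h.step' h3 hi (by omega)).le
      · rw [show i = 1 by omega]
    have a2 : posArc (c 0) (c (2 * n)) ≤ posArc (c 0) (c j) := by
      rcases Nat.lt_or_ge j (2 * n) with h3 | h3
      · exact (h.step' h3 le_rfl (by omega)).le
      · rw [show j = 2 * n by omega]
    exact lt_of_le_of_lt a1 (lt_of_lt_of_le h.2.2.2.2 a2)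
  · exact h.step' (by simp at hij; omega) hi (by omega)

theorem SS.ord_iff {c : ℕ → ℂ} {n : ℕ} (h : SS c n) {i j : ℕ} (hi : i ≤ 2 * n) (hj : j ≤ 2 * n) :
    posArc (c 0) (c i) < posArc (c 0) (c j) ↔ rk n i < rk n j := by
  constructor
  · intro h1
    by_contra h2
    rcases Nat.lt_or_ge (rk n j) (rk n i) with h3 | h3
    · exact absurd (h.ord hj hi h3) (not_lt.2 h1.le)
    · have h4 : rk n i = rk n j := by omega
      have h5 : i = j := by rw [← ix_rk n i h.1 hi, h4, ix_rk n j h.1 hj]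
      rw [h5] at h1
      exact lt_irrefl _ h1
  · exact h.ord hi hj

theorem SS.inj {c : ℕ → ℂ} {n : ℕ} (h : SS c n) {i j : ℕ} (hi : i ≤ 2 * n) (hj : j ≤ 2 * n)
    (hij : c i = c j) : i = j := by
  have h1 := h.ord_iff hi hj
  have h2 := h.ord_iff hj hi
  rw [hij] at h1 h2
  simp only [lt_irrefl, false_iff, not_lt] at h1 h2
  rw [← ix_rk n i h.1 hi, le_antisymm h2 h1, ix_rk n j h.1 hj]

/-- the discrete analogue of `posArc`. -/
def wd (n i j : ℕ) : ℕ :=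
  if rk n i < rk n j then rk n j - rk n i else rk n j + (2 * n + 1) - rk n i

theorem SS.wd_lt {c : ℕ → ℂ} {n : ℕ} (h : SS c n) {i j l : ℕ} (hi : i ≤ 2 * n) (hj : j ≤ 2 * n)
    (hl : l ≤ 2 * n) : posArc (c i) (c j) < posArc (c i) (c l) ↔ wd n i j < wd n i l := by
  rw [posArc_rebase (h.2.1 0) (h.2.1 i) (h.2.1 j), posArc_rebase (h.2.1 0) (h.2.1 i) (h.2.1 l)]
  have r1 := rk_le n i
  have r2 := rk_le n j
  have r3 := rk_le n l
  have o1 := h.ord_iff hi hj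
  have o2 := h.ord_iff hi hl
  have o3 := h.ord_iff hj hl
  have p1 := posArc_pos (c 0) (c i)
  have p2 := posArc_pos (c 0) (c j)
  have p3 := posArc_pos (c 0) (c l)
  have q1 := posArc_le (c 0) (c i)
  have q2 := posArc_le (c 0) (c j)
  have q3 := posArc_le (c 0) (c l)
  unfold wd
  simp only [o1, o2]
  by_cases g1 : rk n i < rk n j <;> by_cases g2 : rk n i < rk n l <;> simp only [g1, g2, if_true, if_false]
  · rw [sub_lt_sub_iff_right, o3]
    omega
  · constructor
    · intro _
      omega
    · intro _
      linarith
  · constructor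
    · intro _
      linarith
    · intro _
      omega
  · rw [add_lt_add_iff_right, sub_lt_sub_iff_right, o3]
    omega

theorem SS.acw {c : ℕ → ℂ} {n : ℕ} (h : SS c n) {i j l : ℕ} (hi : i ≤ 2 * n) (hj : j ≤ 2 * n)
    (hl : l ≤ 2 * n) (hij : i ≠ j) (hjl : j ≠ l) (hil : i ≠ l) (hw : wd n i j < wd n i l) :
    ACW (c i) (c j) (c l) :=
  ⟨fun g => hij (h.inj hi hj g), fun g => hjl (h.inj hj hl g), fun g => hil (h.inj hi hl g),
    (h.wd_lt hi hj hl).2 hw⟩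

/-- The cyclic polygon of a star traversal. -/
def SS.poly {c : ℕ → ℂ} {n : ℕ} (h : SS c n) : CyclicPolygon where
  V := (Finset.range (2 * n + 1)).image c
  E := (Finset.range (2 * n + 1)).image (fun i => (c i, c (i + 1)))
  nonempty := ⟨c 0, Finset.mem_image_of_mem c (by simp)⟩
  onCircle := by
    intro v hv
    obtain ⟨i, -, rfl⟩ := Finset.mem_image.1 hv
    exact h.2.1 i
  endmem := by
    intro e he
    obtain ⟨i, hi, rfl⟩ := Finset.mem_image.1 he
    rw [Finset.mem_range] at hi
    refine ⟨Finset.mem_image_of_mem c (by simpa using hi), ?_⟩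
    rcases Nat.lt_or_ge (i + 1) (2 * n + 1) with h1 | h1
    · exact Finset.mem_image_of_mem c (by simpa using h1)
    · have : i + 1 = 2 * n + 1 := by omega
      simp only [this, h.2.2.1]
      exact Finset.mem_image_of_mem c (by simp)
  outdeg := by
    intro v hv
    obtain ⟨i, hi, rfl⟩ := Finset.mem_image.1 hv
    refine ⟨c (i + 1), Finset.mem_image.2 ⟨i, hi, rfl⟩, ?_⟩
    intro w hw
    obtain ⟨j, hj, hjw⟩ := Finset.mem_image.1 hw
    rw [Finset.mem_range] at hi hj
    have h1 : c j = c i := congrArg Prod.fst hjw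
    have h2 : c (j + 1) = w := congrArg Prod.snd hjw
    rw [← h2, h.inj (by omega) (by omega) h1]
  indeg := by
    intro v hv
    obtain ⟨i, hi, rfl⟩ := Finset.mem_image.1 hv
    rw [Finset.mem_range] at hi
    have huniq : ∀ j, j < 2 * n + 1 → c (j + 1) = c i →
        (j < 2 * n ∧ j + 1 = i) ∨ (j = 2 * n ∧ i = 0) := by
      intro j hj hji
      rcases Nat.lt_or_ge (j + 1) (2 * n + 1) with h1 | h1
      · exact Or.inl ⟨by omega, h.inj (by omega) (by omega) hji⟩
      · have h2 : j = 2 * n := by omega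
        rw [h2, h.2.2.1] at hji
        exact Or.inr ⟨h2, (h.inj (by omega) (by omega) hji).symm⟩
    rcases Nat.eq_zero_or_pos i with h0 | h0
    · subst h0
      refine ⟨c (2 * n), Finset.mem_image.2 ⟨2 * n, by simp, by rw [h.2.2.1]⟩, ?_⟩
      intro w hw
      obtain ⟨j, hj, hjw⟩ := Finset.mem_image.1 hw
      rw [Finset.mem_range] at hj
      have h1 : c j = w := congrArg Prod.fst hjw
      rcases huniq j hj (congrArg Prod.snd hjw) with h2 | h2
      · omega
      · rw [← h1, h2.1]
    · refine ⟨c (i - 1), Finset.mem_image.2 ⟨i - 1, by simp; omega, ?_⟩, ?_⟩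
      · rw [Nat.sub_add_cancel h0]
      intro w hw
      obtain ⟨j, hj, hjw⟩ := Finset.mem_image.1 hw
      rw [Finset.mem_range] at hj
      have h1 : c j = w := congrArg Prod.fst hjw
      rcases huniq j hj (congrArg Prod.snd hjw) with h2 | h2
      · rw [← h1, ← h2.2]
        rfl
      · omega
  acw := by
    intro u v w huv hvw
    obtain ⟨i, hi, hi'⟩ := Finset.mem_image.1 huv
    obtain ⟨j, hj, hj'⟩ := Finset.mem_image.1 hvw
    rw [Finset.mem_range] at hi hj
    have h1 : c i = u := congrArg Prod.fst hi'
    have h2 : c (i + 1) = v := congrArg Prod.snd hi'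
    have h3 : c j = v := congrArg Prod.fst hj'
    have h4 : c (j + 1) = w := congrArg Prod.snd hj'
    have hn := h.1
    rw [← h1, ← h3, ← h4]
    rcases Nat.lt_or_ge i (2 * n) with g | g
    · have hj2 : j = i + 1 := h.inj (by omega) (by omega) (by rw [h2, h3])
      subst hj2
      rcases Nat.lt_or_ge (i + 1) (2 * n) with g2 | g2
      · apply h.acw <;> first | omega | (unfold wd rk; split_ifs <;> omega)
      · rw [show i + 1 + 1 = 2 * n + 1 by omega, h.2.2.1]
        apply h.acw <;> first | omega | (unfold wd rk; split_ifs <;> omega)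
    · have hi2 : i = 2 * n := by omega
      have hj2 : j = 0 := h.inj (by omega) (by omega) (by rw [h3, ← h2, hi2, h.2.2.1])
      subst hi2 hj2
      have e1 : rk n (2 * n) = n := by
        unfold rk
        split_ifs <;> omega
      have e2 : rk n 0 = 2 * n := by simp [rk]
      have e3 : rk n (0 + 1) = n - 1 := by simp [rk]
      apply h.acw <;> first | omega | (unfold wd; rw [e1, e2, e3]; split_ifs <;> omega)

theorem SS.poly_isStar {c : ℕ → ℂ} {n : ℕ} (h : SS c n) : IsStar h.poly := by
  have hn := h.1
  refine ⟨n, hn, ?_, ?_⟩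
  · show ((Finset.range (2 * n + 1)).image c).card = 2 * n + 1
    rw [Finset.card_image_of_injOn, Finset.card_range]
    intro i hi j hj hij
    simp at hi hj
    exact h.inj (by omega) (by omega) hij
  · intro e he
    obtain ⟨i, hi, rfl⟩ := Finset.mem_image.1 he
    rw [Finset.mem_range] at hi
    -- the endpoint index
    obtain ⟨j, hj, hij, hw⟩ : ∃ j, j ≤ 2 * n ∧ c (i + 1) = c j ∧
        (rk n j = rk n i + n ∨ rk n i = rk n j + n + 1) := by
      rcases Nat.lt_or_ge i (2 * n) with g | g
      · refine ⟨i + 1, by omega, rfl, ?_⟩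
        unfold rk
        split_ifs <;> omega
      · have hi2 : i = 2 * n := by omega
        subst hi2
        refine ⟨0, by omega, h.2.2.1, ?_⟩
        unfold rk
        split_ifs <;> omega
    have dinj : ∀ s, s ≤ 2 * n → ∀ s', s' ≤ 2 * n → c (ix n s) = c (ix n s') → s = s' := by
      intro s hs s' hs' hss
      have := h.inj (ix_le n s hn) (ix_le n s' hn) hss
      rw [← rk_ix n s hs, this, rk_ix n s' hs']
    have hset : ((h.poly.V : Set ℂ) ∩ arcOO (c i) (c (i + 1))) =
        (((Finset.range (2 * n + 1)).filter (fun s => s ≠ rk n i ∧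
          (if rk n i < rk n j then rk n i < s ∧ s < rk n j else rk n i < s ∨ s < rk n j))).image
            (fun s => c (ix n s)) : Finset ℂ) := by
      rw [hij]
      have hVdef : h.poly.V = (Finset.range (2 * n + 1)).image c := rfl
      have key : ∀ l, l ≤ 2 * n → (c l ∈ arcOO (c i) (c j) ↔ rk n l ≠ rk n i ∧
          (if rk n i < rk n j then rk n i < rk n l ∧ rk n l < rk n j
            else rk n i < rk n l ∨ rk n l < rk n j)) := by
        intro l hl
        unfold arcOO
        rw [Set.mem_ofPred_eq, h.wd_lt (by omega) hl hj]
        have e1 : c l ≠ c i ↔ rk n l ≠ rk n i := by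
          constructor
          · intro g g'
            apply g
            rw [← ix_rk n l hn hl, g', ix_rk n i hn (by omega)]
          · intro g g'
            exact g (by rw [h.inj hl (by omega) g'])
        have e2 : c l ≠ c j ↔ rk n l ≠ rk n j := by
          constructor
          · intro g g'
            apply g
            rw [← ix_rk n l hn hl, g', ix_rk n j hn (by omega)]
          · intro g g'
            exact g (by rw [h.inj hl (by omega) g'])
        rw [e1, e2]
        have r1 := rk_le n i
        have r2 := rk_le n j
        have r3 := rk_le n l
        unfold wd
        split_ifs <;> omega
      ext x
      simp only [hVdef, Finset.coe_image, Set.mem_inter_iff, Set.mem_image, Finset.coe_filter,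
        Finset.mem_coe, Finset.mem_range, Set.mem_ofPred_eq]
      constructor
      · rintro ⟨⟨l, hl, rfl⟩, hx⟩
        rw [key l (by omega)] at hx
        have := rk_le n l
        exact ⟨rk n l, ⟨by omega, hx⟩, by rw [ix_rk n l hn (by omega)]⟩
      · rintro ⟨s, ⟨hs, hs2⟩, rfl⟩
        have hle := ix_le n s hn
        refine ⟨⟨ix n s, by omega, rfl⟩, ?_⟩
        rw [key _ hle, rk_ix n s (by omega)]
        exact hs2
    unfold edgeLength
    rw [hset, Set.ncard_coe_finset, Finset.card_image_of_injOn]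
    · have r1 := rk_le n i
      have r2 := rk_le n j
      rcases hw with hw | hw
      · have : (Finset.range (2 * n + 1)).filter (fun s => s ≠ rk n i ∧
          (if rk n i < rk n j then rk n i < s ∧ s < rk n j else rk n i < s ∨ s < rk n j)) =
            Finset.Ioo (rk n i) (rk n j) := by
          ext s
          simp only [Finset.mem_filter, Finset.mem_range, Finset.mem_Ioo]
          split_ifs <;> omega
        rw [this, Nat.card_Ioo]
        omega
      · have : (Finset.range (2 * n + 1)).filter (fun s => s ≠ rk n i ∧
          (if rk n i < rk n j then rk n i < s ∧ s < rk n j else rk n i < s ∨ s < rk n j)) =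
            Finset.Ioc (rk n i) (2 * n) ∪ Finset.range (rk n j) := by
          ext s
          simp only [Finset.mem_filter, Finset.mem_range, Finset.mem_Ioc, Finset.mem_union]
          split_ifs <;> omega
        rw [this, Finset.card_union_of_disjoint, Nat.card_Ioc, Finset.card_range]
        · omega
        · rw [Finset.disjoint_left]
          intro s hs
          simp only [Finset.mem_range, Finset.mem_Ioc] at hs ⊢
          omega
    · intro s hs s' hs' hss
      simp only [Finset.coe_filter, Finset.mem_range, Set.mem_ofPred_eq] at hs hs'
      exact dinj s (by omega) s' (by omega) hss

theorem CyclicPolygon.next_mem (S : CyclicPolygon) {v : ℂ} (hv : v ∈ S.V) :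
    (v, S.next v) ∈ S.E := by
  have h : ∃ w, (v, w) ∈ S.E := (S.outdeg v hv).exists
  unfold CyclicPolygon.next
  rw [dif_pos h]
  exact h.choose_spec

theorem CyclicPolygon.prev_mem (S : CyclicPolygon) {v : ℂ} (hv : v ∈ S.V) :
    (S.prev v, v) ∈ S.E := by
  have h : ∃ w, (w, v) ∈ S.E := (S.indeg v hv).exists
  unfold CyclicPolygon.prev
  rw [dif_pos h]
  exact h.choose_spec

theorem CyclicPolygon.next_eq (S : CyclicPolygon) {v w : ℂ} (h : (v, w) ∈ S.E) :
    S.next v = w :=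
  (S.outdeg v (S.endmem _ h).1).unique (S.next_mem (S.endmem _ h).1) h

theorem CyclicPolygon.prev_eq (S : CyclicPolygon) {v w : ℂ} (h : (w, v) ∈ S.E) :
    S.prev v = w :=
  (S.indeg v (S.endmem _ h).2).unique (S.prev_mem (S.endmem _ h).2) h

theorem extract_star {S : CyclicPolygon} (hS : IsStar S) {u₁ u₂ : ℂ} (he : (u₁, u₂) ∈ S.E) :
    ∃ (a : ℕ → ℂ) (k : ℕ), SS a k ∧ a 0 = u₂ ∧ a (2 * k) = u₁ ∧
      (∀ x, x ∈ S.V ↔ ∃ i, i ≤ 2 * k ∧ a i = x) ∧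
      (∀ e, e ∈ S.E ↔ ∃ i, i ≤ 2 * k ∧ e = (a i, a (i + 1))) := by
  obtain ⟨k, hk, hcard, hlen⟩ := hS
  have hu1 : u₁ ∈ S.V := (S.endmem _ he).1
  have hu2 : u₂ ∈ S.V := (S.endmem _ he).2
  have hun : ∀ x ∈ S.V, ‖x‖ = 1 := S.onCircle
  obtain ⟨t, ht⟩ : ∃ t : ℂ → ℝ, t = posArc u₂ := ⟨_, rfl⟩
  obtain ⟨r, hr⟩ : ∃ r : ℂ → ℕ, ∀ x, r x = (S.V.filter (fun y => t y < t x)).card :=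
    ⟨_, fun _ => rfl⟩
  have tinj : ∀ x ∈ S.V, ∀ y ∈ S.V, t x = t y → x = y := by
    intro x hx y hy hxy
    rw [ht] at hxy
    exact posArc_inj (hun _ hu2) (hun _ hx) (hun _ hy) hxy
  have rmono : ∀ x ∈ S.V, ∀ y ∈ S.V, t x < t y → r x < r y := by
    intro x hx y hy hxy
    rw [hr, hr]
    apply Finset.card_lt_card
    rw [Finset.ssubset_iff_of_subset]
    · exact ⟨x, by simp [hx, hxy], by simp⟩
    · intro z hz
      simp only [Finset.mem_filter] at hz ⊢
      exact ⟨hz.1, hz.2.trans hxy⟩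
  have rinj : ∀ x ∈ S.V, ∀ y ∈ S.V, r x = r y → x = y := by
    intro x hx y hy hxy
    rcases lt_trichotomy (t x) (t y) with g | g | g
    · have := rmono x hx y hy g
      omega
    · exact tinj x hx y hy g
    · have := rmono y hy x hx g
      omega
  have rlt : ∀ x ∈ S.V, ∀ y ∈ S.V, r x < r y → t x < t y := by
    intro x hx y hy hxy
    rcases lt_trichotomy (t x) (t y) with g | g | g
    · exact g
    · rw [tinj x hx y hy g] at hxy
      omega
    · have := rmono y hy x hx g
      omega
  have rsplit : ∀ x ∈ S.V, S.V.card = r x + 1 + (S.V.filter (fun y => t x < t y)).card := by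
    intro x hx
    have hV : S.V = (S.V.filter (fun y => t y < t x) ∪ {x}) ∪ S.V.filter (fun y => t x < t y) := by
      ext z
      simp only [Finset.mem_union, Finset.mem_filter, Finset.mem_singleton]
      constructor
      · intro hz
        rcases lt_trichotomy (t z) (t x) with g | g | g
        · exact Or.inl (Or.inl ⟨hz, g⟩)
        · exact Or.inl (Or.inr (tinj z hz x hx g))
        · exact Or.inr ⟨hz, g⟩
      · rintro ((h | rfl) | h)
        · exact h.1
        · exact hx
        · exact h.1
    conv_lhs => rw [hV]
    rw [Finset.card_union_of_disjoint, Finset.card_union_of_disjoint, hr, Finset.card_singleton]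
    · simp
    · rw [Finset.disjoint_left]
      intro z hz
      simp only [Finset.mem_union, Finset.mem_filter, Finset.mem_singleton] at hz ⊢
      rintro ⟨_, h2⟩
      rcases hz with hz | rfl
      · exact absurd hz.2 (not_lt.2 h2.le)
      · exact lt_irrefl _ h2
  have rle : ∀ x ∈ S.V, r x ≤ 2 * k := by
    intro x hx
    have := rsplit x hx
    omega
  have redge : ∀ x y, (x, y) ∈ S.E → r y = r x + k ∨ r x = r y + k + 1 := by
    intro x y hxy
    have hx : x ∈ S.V := (S.endmem _ hxy).1
    have hy : y ∈ S.V := (S.endmem _ hxy).2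
    have hne : x ≠ y := (S.acw _ _ _ hxy (S.next_mem hy)).1
    have hl := hlen _ hxy
    unfold edgeLength at hl
    simp only at hl
    have hreb : ∀ z ∈ S.V, posArc x z =
        if t x < t z then t z - t x else t z - t x + 2 * Real.pi := by
      intro z hz
      rw [ht]
      exact posArc_rebase (hun _ hu2) (hun _ hx) (hun _ hz)
    have tpos : ∀ z, 0 < t z := by
      intro z
      rw [ht]
      exact posArc_pos _ _
    have tle : ∀ z, t z ≤ 2 * Real.pi := by
      intro z
      rw [ht]
      exact posArc_le _ _
    rcases lt_trichotomy (t x) (t y) with g | g | g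
    · left
      have hset : ((S.V : Set ℂ) ∩ arcOO x y) =
          (S.V.filter (fun z => t x < t z ∧ t z < t y) : Finset ℂ) := by
        ext z
        simp only [arcOO, Set.mem_inter_iff, Finset.mem_coe, Set.mem_ofPred_eq, Finset.mem_filter]
        constructor
        · rintro ⟨hz, h1, h2, h3⟩
          rw [hreb z hz, hreb y hy, if_pos g] at h3
          have p1 := tpos z
          have p2 := tle y
          split_ifs at h3 with g2
          · exact ⟨hz, g2, by linarith⟩
          · linarith
        · rintro ⟨hz, h1, h2⟩
          refine ⟨hz, ?_, ?_, ?_⟩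
          · rintro rfl
            exact lt_irrefl _ h1
          · rintro rfl
            exact lt_irrefl _ h2
          · rw [hreb z hz, hreb y hy, if_pos g, if_pos h1]
            linarith
      rw [hset, Set.ncard_coe_finset] at hl
      have hV : S.V.filter (fun z => t z < t y) = (S.V.filter (fun z => t z < t x) ∪ {x}) ∪
          S.V.filter (fun z => t x < t z ∧ t z < t y) := by
        ext z
        simp only [Finset.mem_union, Finset.mem_filter, Finset.mem_singleton]
        constructor
        · rintro ⟨hz, hzy⟩
          rcases lt_trichotomy (t z) (t x) with g | g | g
          · exact Or.inl (Or.inl ⟨hz, g⟩)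
          · exact Or.inl (Or.inr (tinj z hz x hx g))
          · exact Or.inr ⟨hz, g, hzy⟩
        · rintro ((h | rfl) | h)
          · exact ⟨h.1, h.2.trans g⟩
          · exact ⟨hx, g⟩
          · exact ⟨h.1, h.2.2⟩
      have hc := congrArg Finset.card hV
      rw [← hr, Finset.card_union_of_disjoint, Finset.card_union_of_disjoint, ← hr,
        Finset.card_singleton] at hc
      · omega
      · simp
      · rw [Finset.disjoint_left]
        intro z hz
        simp only [Finset.mem_union, Finset.mem_filter, Finset.mem_singleton] at hz ⊢
        rintro ⟨_, h2, _⟩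
        rcases hz with hz | rfl
        · exact absurd hz.2 (not_lt.2 h2.le)
        · exact lt_irrefl _ h2
    · exact absurd (tinj x hx y hy g) hne
    · right
      have hset : ((S.V : Set ℂ) ∩ arcOO x y) =
          (S.V.filter (fun z => t z < t y) ∪ S.V.filter (fun z => t x < t z) : Finset ℂ) := by
        ext z
        simp only [arcOO, Set.mem_inter_iff, Finset.mem_coe, Set.mem_ofPred_eq, Finset.mem_filter,
          Finset.mem_union]
        constructor
        · rintro ⟨hz, h1, h2, h3⟩
          rw [hreb z hz, hreb y hy, if_neg (not_lt.2 g.le)] at h3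
          split_ifs at h3 with g2
          · exact Or.inr ⟨hz, g2⟩
          · exact Or.inl ⟨hz, by linarith⟩
        · rintro (⟨hz, h1⟩ | ⟨hz, h1⟩)
          · refine ⟨hz, ?_, ?_, ?_⟩
            · rintro rfl
              linarith
            · rintro rfl
              linarith
            · rw [hreb z hz, hreb y hy, if_neg (not_lt.2 g.le), if_neg (by linarith)]
              linarith
          · refine ⟨hz, ?_, ?_, ?_⟩
            · rintro rfl
              linarith
            · rintro rfl
              linarith
            · rw [hreb z hz, hreb y hy, if_neg (not_lt.2 g.le), if_pos h1]
              have p1 := tpos y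
              have p2 := tle z
              linarith
      rw [hset, Set.ncard_coe_finset, Finset.card_union_of_disjoint, ← hr] at hl
      · have := rsplit x hx
        omega
      · rw [Finset.disjoint_left]
        intro z hz
        simp only [Finset.mem_filter] at hz ⊢
        rintro ⟨_, h2⟩
        linarith [hz.2]
  -- the traversal
  obtain ⟨a, ha⟩ : ∃ a : ℕ → ℂ, a = fun i => S.next^[i] u₂ := ⟨_, rfl⟩
  have ha0 : a 0 = u₂ := by simp [ha]
  have has : ∀ i, a (i + 1) = S.next (a i) := by
    intro i
    simp only [ha, Function.iterate_succ_apply']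
  have hmem : ∀ i, a i ∈ S.V := by
    intro i
    induction i with
    | zero => rw [ha0]; exact hu2
    | succ i ih =>
      rw [has]
      exact (S.endmem _ (S.next_mem ih)).2
  have hedge : ∀ i, (a i, a (i + 1)) ∈ S.E := by
    intro i
    rw [has]
    exact S.next_mem (hmem i)
  have r0 : r u₂ = 2 * k := by
    have h1 := rsplit u₂ hu2
    have h2 : S.V.filter (fun y => t u₂ < t y) = ∅ := by
      apply Finset.filter_eq_empty_iff.2
      intro y hy
      rw [ht, posArc_self (hun _ hu2), not_lt]
      exact posArc_le _ _
    rw [h2, Finset.card_empty] at h1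
    omega
  have ra : ∀ i, i ≤ 2 * k → r (a i) = rk k i := by
    intro i
    induction i with
    | zero =>
      intro _
      rw [ha0, r0]
      simp [rk]
    | succ i ih =>
      intro hi
      have h1 := ih (by omega)
      have h2 := redge _ _ (hedge i)
      have h3 := rle _ (hmem (i + 1))
      unfold rk at h1 ⊢
      split_ifs at h1 ⊢ <;> omega
  have ru1 : r u₁ = k := by
    have h2 := redge _ _ he
    have h3 := rle _ hu1
    omega
  have hcov : ∀ x ∈ S.V, ∃ i, i ≤ 2 * k ∧ a i = x := by
    intro x hx
    refine ⟨ix k (r x), ix_le k _ hk, ?_⟩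
    apply rinj _ (hmem _) _ hx
    rw [ra _ (ix_le k _ hk), rk_ix k _ (rle x hx)]
  have ha2k : a (2 * k) = u₁ := by
    apply rinj _ (hmem _) _ hu1
    rw [ra _ le_rfl, ru1]
    unfold rk
    split_ifs <;> omega
  refine ⟨a, k, ⟨hk, fun i => hun _ (hmem i), ?_, ?_, ?_⟩, ha0, ha2k, ?_, ?_⟩
  · rw [has, ha2k, ha0]
    exact S.next_eq he
  · intro i hi
    rw [ha0, ← ht]
    apply rlt _ (hmem _) _ (hmem _)
    rw [ra _ hi, ra _ (by omega)]
    unfold rk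
    split_ifs <;> omega
  · rw [ha0, ← ht]
    apply rlt _ (hmem _) _ (hmem _)
    rw [ra _ (by omega), ra _ le_rfl]
    have e1 : rk k (2 * k) = k := by
      unfold rk
      split_ifs <;> omega
    have e3 : rk k 1 = k - 1 := by simp [rk]
    omega
  · intro x
    constructor
    · exact hcov x
    · rintro ⟨i, _, rfl⟩
      exact hmem i
  · rintro ⟨x, y⟩
    constructor
    · intro hxy
      obtain ⟨i, hi, rfl⟩ := hcov x (S.endmem _ hxy).1
      refine ⟨i, hi, ?_⟩
      rw [has, S.next_eq hxy]
    · rintro ⟨i, _, hi⟩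
      rw [hi]
      exact hedge i

/-- The concatenated traversal. -/
def cat (a b : ℕ → ℂ) (p q : ℕ) : ℕ → ℂ := fun i => if i ≤ p then a i else b (q + (i - p - 1))

theorem merge_star {a b : ℕ → ℂ} {k m p q : ℕ} (ha : SS a k) (hb : SS b m)
    (h1 : a 0 = b (2 * m)) (h2 : a (2 * k) = b 0)
    (hp0 : 0 < p) (hp : p < 2 * k) (hq0 : 0 < q) (hq : q < 2 * m)
    (l1 : posArc (a p) (a (p + 1)) < posArc (a p) (b q))
    (l2 : posArc (a p) (b q) < posArc (a p) (a (p - 1)))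
    (l3 : posArc (b q) (b (q + 1)) < posArc (b q) (a p))
    (l4 : posArc (b q) (a p) < posArc (b q) (b (q - 1))) :
    ∃ n, 2 * n = p + 2 * m - q ∧ SS (cat a b p q) n := by
  have una := ha.2.1
  have unb := hb.2.1
  -- positions relative to `a 0`
  have bpos : ∀ i, i < 2 * m → posArc (a 0) (b i) =
      if i % 2 = 0 then posArc (b 0) (b i) - posArc (b 0) (b (2 * m))
      else posArc (b 0) (b i) - posArc (b 0) (b (2 * m)) + 2 * Real.pi := by
    intro i hi
    rw [h1, posArc_rebase (unb 0) (unb (2 * m)) (unb i)]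
    simp only [hb.ord_iff (le_refl (2 * m)) hi.le]
    congr 1
    unfold rk
    apply propext
    split_ifs <;> omega
  have hu : posArc (a 0) (a (2 * k)) = 2 * Real.pi - posArc (b 0) (b (2 * m)) := by
    have := bpos 0 (by omega)
    rw [h2, this, posArc_self (unb 0)]
    simp
  have bmono : ∀ i j, i < j → j < 2 * m → i % 2 = j % 2 →
      posArc (a 0) (b j) < posArc (a 0) (b i) := by
    intro i j hij hj hpar
    rw [bpos i (by omega), bpos j hj, hpar]
    have := hb.step' hij hj.le hpar
    split_ifs <;> linarith
  have bodd : ∀ i, i < 2 * m → i % 2 = 1 → posArc (a 0) (a (2 * k)) < posArc (a 0) (b i) := by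
    intro i hi hpar
    rw [hu, bpos i hi, if_neg (by omega)]
    linarith [posArc_pos (b 0) (b i)]
  have beven : ∀ i, i < 2 * m → i % 2 = 0 → posArc (a 0) (b i) ≤ posArc (a 0) (a (2 * k)) := by
    intro i hi hpar
    rw [hu, bpos i hi, if_pos hpar]
    linarith [posArc_le (b 0) (b i)]
  have aodd : ∀ i, i ≤ 2 * k → i % 2 = 1 → posArc (a 0) (a i) < posArc (a 0) (a (2 * k)) := by
    intro i hi hpar
    apply ha.ord hi le_rfl
    unfold rk
    split_ifs <;> omega
  have aeven : ∀ i, i < 2 * k → i % 2 = 0 → posArc (a 0) (a (2 * k)) < posArc (a 0) (a i) := by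
    intro i hi hpar
    exact ha.step' hi le_rfl (by omega)
  -- consequences of linkability
  have L1 : posArc (a 0) (a (p + 1)) < posArc (a 0) (b q) ∧
      posArc (a 0) (b q) < posArc (a 0) (a (p - 1)) := by
    rw [posArc_rebase (una 0) (una p) (una (p + 1)), posArc_rebase (una 0) (una p) (unb q)] at l1
    rw [posArc_rebase (una 0) (una p) (unb q), posArc_rebase (una 0) (una p) (una (p - 1))] at l2
    have c1 := posArc_pos (a 0) (b q)
    have c2 := posArc_le (a 0) (b q)
    have c3 := posArc_pos (a 0) (a (p + 1))
    have c4 := posArc_le (a 0) (a (p + 1))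
    have c5 := posArc_pos (a 0) (a (p - 1))
    have c6 := posArc_le (a 0) (a (p - 1))
    rcases Nat.mod_two_eq_zero_or_one p with hpar | hpar
    · have d1 := aeven p hp hpar
      have d2 := aodd (p + 1) (by omega) (by omega)
      have d3 := aodd (p - 1) (by omega) (by omega)
      rw [if_neg (by linarith)] at l1
      rw [if_neg (by linarith : ¬ posArc (a 0) (a p) < posArc (a 0) (a (p - 1)))] at l2
      split_ifs at l1 l2
      · linarith
      · constructor <;> linarith
    · have d1 := aodd p hp.le hpar
      have d2 : posArc (a 0) (a (2 * k)) ≤ posArc (a 0) (a (p + 1)) := by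
        rcases Nat.lt_or_ge (p + 1) (2 * k) with g | g
        · exact (aeven (p + 1) g (by omega)).le
        · rw [show p + 1 = 2 * k by omega]
      have d3 := aeven (p - 1) (by omega) (by omega)
      rw [if_pos (by linarith)] at l1
      rw [if_pos (by linarith : posArc (a 0) (a p) < posArc (a 0) (a (p - 1)))] at l2
      split_ifs at l1 l2
      · constructor <;> linarith
      · linarith
  have hpar : p % 2 = q % 2 := by
    rcases Nat.mod_two_eq_zero_or_one p with g | g <;>
    rcases Nat.mod_two_eq_zero_or_one q with g' | g'
    · omega
    · have := bodd q hq g'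
      have := aodd (p - 1) (by omega) (by omega)
      linarith
    · have := beven q hq g'
      have d2 : posArc (a 0) (a (2 * k)) ≤ posArc (a 0) (a (p + 1)) := by
        rcases Nat.lt_or_ge (p + 1) (2 * k) with g | g
        · exact (aeven (p + 1) g (by omega)).le
        · rw [show p + 1 = 2 * k by omega]
      linarith
    · omega
  have L2 : q + 1 < 2 * m → posArc (a 0) (b (q + 1)) < posArc (a 0) (a p) := by
    intro hq1
    rcases Nat.mod_two_eq_zero_or_one q with g | g
    · rw [posArc_rebase (una 0) (unb q) (unb (q + 1)), posArc_rebase (una 0) (unb q) (una p)] at l3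
      have d1 := beven q hq g
      have d2 := bodd (q + 1) hq1 (by omega)
      have d3 := aeven p hp (by omega)
      rw [if_pos (by linarith), if_pos (by linarith)] at l3
      linarith
    · rw [posArc_rebase (una 0) (unb q) (unb (q + 1)), posArc_rebase (una 0) (unb q) (una p)] at l3
      have d1 := bodd q hq g
      have d2 := beven (q + 1) hq1 (by omega)
      have d3 := aodd p hp.le (by omega)
      rw [if_neg (by linarith), if_neg (by linarith)] at l3
      linarith
  obtain ⟨n, hn⟩ : ∃ n, 2 * n = p + 2 * m - q := ⟨(p + 2 * m - q) / 2, by omega⟩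
  have clo : ∀ i, i ≤ p → cat a b p q i = a i := fun i hi => if_pos hi
  have chi : ∀ i j, p < i → j = q + (i - p - 1) → cat a b p q i = b j := by
    intro i j hi hj
    rw [hj]
    exact if_neg (by omega)
  refine ⟨n, hn, by omega, ?_, ?_, ?_, ?_⟩
  · intro i
    unfold cat
    split_ifs
    · exact una i
    · exact unb _
  · rw [chi (2 * n + 1) (2 * m) (by omega) (by omega), clo 0 (by omega), h1]
  · intro i hi
    rw [clo 0 (by omega)]
    rcases Nat.lt_or_ge p (i + 2) with g | g
    · rw [chi (i + 2) (q + (i + 2 - p - 1)) g rfl]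
      rcases Nat.lt_or_ge p i with g2 | g2
      · rw [chi i (q + (i - p - 1)) g2 rfl]
        apply bmono <;> omega
      · rw [clo i g2]
        rcases Nat.lt_or_ge i p with g3 | g3
        · rw [show q + (i + 2 - p - 1) = q by omega, show i = p - 1 by omega]
          exact L1.2
        · have : i = p := by omega
          subst this
          rw [show q + (i + 2 - i - 1) = q + 1 by omega]
          exact L2 (by omega)
    · rw [clo _ g, clo i (by omega)]
      exact ha.2.2.2.1 i (by omega)
  · rw [clo 0 (by omega), clo 1 (by omega), chi (2 * n) (2 * m - 1) (by omega) (by omega)]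
    have := aodd 1 (by omega) (by omega)
    have := bodd (2 * m - 1) (by omega) (by omega)
    linarith

theorem link_pos {S : CyclicPolygon} {a : ℕ → ℂ} {k p : ℕ} (ha : SS a k)
    (hE : ∀ e, e ∈ S.E ↔ ∃ i, i ≤ 2 * k ∧ e = (a i, a (i + 1))) (hp : p ≤ 2 * k) {w : ℂ}
    (hw : ‖w‖ = 1) (hne : w ≠ a p) (hs : SplitsVertexAngle S (a p) w) :
    (∀ j, j ≤ 2 * k → w ≠ a j) ∧ (0 < p → p < 2 * k →
      posArc (a p) (a (p + 1)) < posArc (a p) w ∧ posArc (a p) w < posArc (a p) (a (p - 1))) := by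
  have hk := ha.1
  obtain ⟨x, hx, hxn⟩ : ∃ x, x ≤ 2 * k ∧ S.next (a p) = a x ∧ x = if p = 2 * k then 0 else p + 1 := by
    refine ⟨_, ?_, ?_, rfl⟩
    · split_ifs <;> omega
    · apply S.next_eq
      rw [hE]
      refine ⟨p, hp, ?_⟩
      split_ifs with g
      · rw [g, ha.2.2.1]
      · rfl
  obtain ⟨y, hy, hyn⟩ : ∃ y, y ≤ 2 * k ∧ S.prev (a p) = a y ∧ y = if p = 0 then 2 * k else p - 1 := by
    refine ⟨_, ?_, ?_, rfl⟩
    · split_ifs <;> omega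
    · apply S.prev_eq
      rw [hE]
      split_ifs with g
      · exact ⟨2 * k, le_rfl, by rw [g, ha.2.2.1]⟩
      · exact ⟨p - 1, by omega, by rw [Nat.sub_add_cancel (by omega)]⟩
  obtain ⟨hxn, hxe⟩ := hxn
  obtain ⟨hyn, hye⟩ := hyn
  obtain ⟨-, s1, s2, s3⟩ := hs
  rw [hxn] at s2 s3
  rw [hyn] at s1 s3
  have hxp : x ≠ p := by
    rw [hxe]
    split_ifs <;> omega
  have hyp : y ≠ p := by
    rw [hye]
    split_ifs <;> omega
  have hadj : rk k y = rk k x + 1 ∨ (rk k y = 0 ∧ rk k x = 2 * k) := by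
    have e0 : rk k 0 = 2 * k := by simp [rk]
    have e1 : rk k 1 = k - 1 := by simp [rk]
    have e2 : rk k (2 * k) = k := by
      unfold rk
      split_ifs <;> omega
    have e3 : rk k (2 * k - 1) = 0 := by
      unfold rk
      split_ifs <;> omega
    split_ifs at hxe hye with g1 g2
    · omega
    · rw [hxe, hye, g1, e0, e3]
      omega
    · rw [hxe, hye, ‹p = 0›, e1, e2]
      omega
    · rw [hxe, hye]
      unfold rk
      split_ifs <;> omega
  have hrx : rk k x ≠ rk k p := by
    intro g
    apply hxp
    rw [← ix_rk k x hk hx, g, ix_rk k p hk hp]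
  have hry : rk k y ≠ rk k p := by
    intro g
    apply hyp
    rw [← ix_rk k y hk hy, g, ix_rk k p hk hp]
  have r1 := rk_le k x
  have r2 := rk_le k y
  have r3 := rk_le k p
  have hlt : posArc (a p) (a x) < posArc (a p) (a y) := by
    rw [ha.wd_lt hp hx hy]
    unfold wd
    split_ifs <;> omega
  have main := split_arc (ha.2.1 p) (ha.2.1 y) hw (ha.2.1 x) (fun g => hyp (ha.inj hy hp g)) hne
    (fun g => hxp (ha.inj hx hp g)) hlt s1 s2 s3
  constructor
  · intro j hj hwj
    rw [hwj, ha.wd_lt hp hx hj, ha.wd_lt hp hj hy] at main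
    have r4 := rk_le k j
    unfold wd at main
    split_ifs at main <;> omega
  · intro h0 h1
    rw [if_neg (by omega)] at hxe hye
    rw [hxe, hye] at main
    exact main

theorem cat_V {a b : ℕ → ℂ} {m p q n : ℕ} (hn : 2 * n = p + 2 * m - q) (hq : q < 2 * m)
    (h : SS (cat a b p q) n) (x : ℂ) :
    x ∈ h.poly.V ↔ (∃ i, i ≤ p ∧ a i = x) ∨ (∃ j, q ≤ j ∧ j < 2 * m ∧ b j = x) := by
  have hV : h.poly.V = (Finset.range (2 * n + 1)).image (cat a b p q) := rfl
  rw [hV, Finset.mem_image]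
  constructor
  · rintro ⟨i, hi, rfl⟩
    rw [Finset.mem_range] at hi
    unfold cat
    split_ifs with g
    · exact Or.inl ⟨i, g, rfl⟩
    · exact Or.inr ⟨_, by omega, by omega, rfl⟩
  · rintro (⟨i, hi, rfl⟩ | ⟨j, hj, hj2, rfl⟩)
    · exact ⟨i, by rw [Finset.mem_range]; omega, if_pos hi⟩
    · refine ⟨p + 1 + (j - q), by rw [Finset.mem_range]; omega, ?_⟩
      unfold cat
      rw [if_neg (by omega)]
      congr 1
      omega

theorem cat_E {a b : ℕ → ℂ} {m p q n : ℕ} (hn : 2 * n = p + 2 * m - q) (hq : q < 2 * m)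
    (h : SS (cat a b p q) n) (e : ℂ × ℂ) :
    e ∈ h.poly.E ↔ (∃ i, i < p ∧ e = (a i, a (i + 1))) ∨ e = (a p, b q) ∨
      (∃ j, q ≤ j ∧ j < 2 * m ∧ e = (b j, b (j + 1))) := by
  have hE : h.poly.E = (Finset.range (2 * n + 1)).image
    (fun i => (cat a b p q i, cat a b p q (i + 1))) := rfl
  rw [hE, Finset.mem_image]
  have clo : ∀ i, i ≤ p → cat a b p q i = a i := fun i hi => if_pos hi
  have chi : ∀ i j, p < i → j = q + (i - p - 1) → cat a b p q i = b j := by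
    intro i j hi hj
    rw [hj]
    exact if_neg (by omega)
  constructor
  · rintro ⟨i, hi, rfl⟩
    rw [Finset.mem_range] at hi
    rcases lt_trichotomy i p with g | g | g
    · exact Or.inl ⟨i, g, by rw [clo i g.le, clo (i + 1) g]⟩
    · right
      left
      rw [clo i g.le, chi (i + 1) q (by omega) (by omega), g]
    · right
      right
      refine ⟨q + (i - p - 1), by omega, by omega, ?_⟩
      rw [chi i _ g rfl, chi (i + 1) (q + (i - p - 1) + 1) (by omega) (by omega)]
  · rintro (⟨i, hi, rfl⟩ | rfl | ⟨j, hj, hj2, rfl⟩)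
    · exact ⟨i, by rw [Finset.mem_range]; omega, by rw [clo i hi.le, clo (i + 1) hi]⟩
    · exact ⟨p, by rw [Finset.mem_range]; omega,
        by rw [clo p le_rfl, chi (p + 1) q (by omega) (by omega)]⟩
    · exact ⟨p + 1 + (j - q), by rw [Finset.mem_range]; omega,
        by rw [chi (p + 1 + (j - q)) j (by omega) (by omega),
          chi (p + 1 + (j - q) + 1) (j + 1) (by omega) (by omega)]⟩

/-- Removing the closing edge of a star traversal. -/
theorem SS.not_close {a : ℕ → ℂ} {k i : ℕ} (ha : SS a k) (hi : i < 2 * k) :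
    (a i, a (i + 1)) ≠ (a (2 * k), a 0) ∧ (a i, a (i + 1)) ≠ (a 0, a (2 * k)) := by
  have hk := ha.1
  constructor
  · intro g
    have := ha.inj (by omega) (by omega) (congrArg Prod.fst g)
    omega
  · intro g
    have g1 := ha.inj (by omega) (by omega) (congrArg Prod.fst g)
    have g2 := ha.inj (by omega) (by omega) (congrArg Prod.snd g)
    omega

/-- (Diagonal flip of a double star.) If two stars of a star decomposition
form a double star with common diagonal `u₁u₂`, and `(v₁, v₂)` is a linkable pair of the two
stars, then the common diagonal may be replaced by `v₁v₂`, yielding a new double star on the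
same vertices. -/
theorem double_star_flip (P : CyclicPolygon) (D : Set (Sym2 ℂ)) (𝒮 : Finset CyclicPolygon)
    (h : IsStarDecomp P D 𝒮) (S₁ S₂ : CyclicPolygon) (hS₁ : S₁ ∈ 𝒮) (hS₂ : S₂ ∈ 𝒮)
    (hne : S₁ ≠ S₂) (u₁ u₂ v₁ v₂ : ℂ)
    (hd : s(u₁, u₂) ∈ D) (he₁ : (u₁, u₂) ∈ S₁.E) (he₂ : (u₂, u₁) ∈ S₂.E)
    (hv₁ : v₁ ∈ S₁.V) (hv₂ : v₂ ∈ S₂.V) (hlink : LinkablePair S₁ S₂ v₁ v₂) :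
    ∃ S₁' S₂' : CyclicPolygon, IsStar S₁' ∧ IsStar S₂' ∧
      (v₁, v₂) ∈ S₁'.E ∧ (v₂, v₁) ∈ S₂'.E ∧
      ((S₁'.V : Set ℂ) ∪ (S₂'.V : Set ℂ)) = ((S₁.V : Set ℂ) ∪ (S₂.V : Set ℂ)) ∧
      ((S₁'.E : Set (ℂ × ℂ)) ∪ (S₂'.E : Set (ℂ × ℂ))) =
        ((((S₁.E : Set (ℂ × ℂ)) ∪ (S₂.E : Set (ℂ × ℂ))) \ {(u₁, u₂), (u₂, u₁)}) ∪
          {(v₁, v₂), (v₂, v₁)}) := by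
  obtain ⟨a, k, ha, ha0, hak, haV, haE⟩ := extract_star (h.2.1 S₁ hS₁).1 he₁
  obtain ⟨b, m, hb, hb0, hbm, hbV, hbE⟩ := extract_star (h.2.1 S₂ hS₂).1 he₂
  obtain ⟨p, hp, rfl⟩ := (haV v₁).1 hv₁
  obtain ⟨q, hq, rfl⟩ := (hbV v₂).1 hv₂
  obtain ⟨hvne, hl1, hl2⟩ := hlink
  obtain ⟨n1, k1⟩ := link_pos ha haE hp (hb.2.1 q) hvne.symm hl1
  obtain ⟨n2, k2⟩ := link_pos hb hbE hq (ha.2.1 p) hvne hl2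
  have hp0 : 0 < p := by
    rcases Nat.eq_zero_or_pos p with g | g
    · exact absurd (by rw [g, ha0, hbm]) (n2 (2 * m) le_rfl)
    · exact g
  have hp2 : p < 2 * k := by
    rcases Nat.lt_or_ge p (2 * k) with g | g
    · exact g
    · exact absurd (by rw [show p = 2 * k by omega, hak, hb0]) (n2 0 (by omega))
  have hq0 : 0 < q := by
    rcases Nat.eq_zero_or_pos q with g | g
    · exact absurd (by rw [g, hb0, hak]) (n1 (2 * k) le_rfl)
    · exact g
  have hq2 : q < 2 * m := by
    rcases Nat.lt_or_ge q (2 * m) with g | g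
    · exact g
    · exact absurd (by rw [show q = 2 * m by omega, hbm, ha0]) (n1 0 (by omega))
  have k1' := k1 hp0 hp2
  have k2' := k2 hq0 hq2
  have e1 : a 0 = b (2 * m) := by rw [ha0, hbm]
  have e2 : a (2 * k) = b 0 := by rw [hak, hb0]
  obtain ⟨n, hn, hc⟩ := merge_star ha hb e1 e2 hp0 hp2 hq0 hq2 k1'.1 k1'.2 k2'.1 k2'.2
  obtain ⟨n', hn', hc'⟩ := merge_star hb ha e2.symm e1.symm hq0 hq2 hp0 hp2
    k2'.1 k2'.2 k1'.1 k1'.2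
  refine ⟨hc.poly, hc'.poly, hc.poly_isStar, hc'.poly_isStar, ?_, ?_, ?_, ?_⟩
  · rw [cat_E hn hq2]
    exact Or.inr (Or.inl rfl)
  · rw [cat_E hn' hp2]
    exact Or.inr (Or.inl rfl)
  · ext x
    simp only [Set.mem_union, Finset.mem_coe]
    rw [cat_V hn hq2, cat_V hn' hp2, haV, hbV]
    constructor
    · rintro ((⟨i, hi, rfl⟩ | ⟨i, hi, hi', rfl⟩) | (⟨i, hi, rfl⟩ | ⟨i, hi, hi', rfl⟩))
      · exact Or.inl ⟨i, by omega, rfl⟩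
      · exact Or.inr ⟨i, by omega, rfl⟩
      · exact Or.inr ⟨i, by omega, rfl⟩
      · exact Or.inl ⟨i, by omega, rfl⟩
    · rintro (⟨i, hi, rfl⟩ | ⟨i, hi, rfl⟩)
      · rcases Nat.lt_or_ge p i with g | g
        · rcases Nat.lt_or_ge i (2 * k) with g' | g'
          · exact Or.inr (Or.inr ⟨i, by omega, g', rfl⟩)
          · exact Or.inr (Or.inl ⟨0, by omega, by rw [show i = 2 * k by omega, e2]⟩)
        · exact Or.inl (Or.inl ⟨i, g, rfl⟩)
      · rcases Nat.lt_or_ge q i with g | g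
        · rcases Nat.lt_or_ge i (2 * m) with g' | g'
          · exact Or.inl (Or.inr ⟨i, by omega, g', rfl⟩)
          · exact Or.inl (Or.inl ⟨0, by omega, by rw [show i = 2 * m by omega, e1]⟩)
        · exact Or.inr (Or.inl ⟨i, g, rfl⟩)
  · have ca : ∀ i, i < 2 * k → (a i, a (i + 1)) ∉ ({(u₁, u₂), (u₂, u₁)} : Set (ℂ × ℂ)) := by
      intro i hi hmem
      have := ha.not_close hi
      rw [ha0, hak] at this
      rcases hmem with g | g
      · exact this.1 g
      · exact this.2 g
    have cb : ∀ i, i < 2 * m → (b i, b (i + 1)) ∉ ({(u₁, u₂), (u₂, u₁)} : Set (ℂ × ℂ)) := by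
      intro i hi hmem
      have := hb.not_close hi
      rw [hb0, hbm] at this
      rcases hmem with g | g
      · exact this.2 g
      · exact this.1 g
    ext e
    simp only [Set.mem_union, Finset.mem_coe, Set.mem_diff]
    rw [cat_E hn hq2, cat_E hn' hp2, haE, hbE]
    constructor
    · rintro ((⟨i, hi, rfl⟩ | rfl | ⟨i, hi, hi', rfl⟩) | (⟨i, hi, rfl⟩ | rfl | ⟨i, hi, hi', rfl⟩))
      · exact Or.inl ⟨Or.inl ⟨i, by omega, rfl⟩, ca i (by omega)⟩
      · exact Or.inr (Or.inl rfl)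
      · exact Or.inl ⟨Or.inr ⟨i, by omega, rfl⟩, cb i (by omega)⟩
      · exact Or.inl ⟨Or.inr ⟨i, by omega, rfl⟩, cb i (by omega)⟩
      · exact Or.inr (Or.inr rfl)
      · exact Or.inl ⟨Or.inl ⟨i, by omega, rfl⟩, ca i (by omega)⟩
    · rintro (⟨⟨i, hi, rfl⟩ | ⟨i, hi, rfl⟩, hnot⟩ | (rfl | rfl))
      · have hi2 : i < 2 * k := by
          rcases Nat.lt_or_ge i (2 * k) with g | g
          · exact g
          · exfalso
            apply hnot
            rw [show i = 2 * k by omega, ha.2.2.1, hak, ha0]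
            exact Or.inl rfl
        rcases Nat.lt_or_ge i p with g | g
        · exact Or.inl (Or.inl ⟨i, g, rfl⟩)
        · exact Or.inr (Or.inr (Or.inr ⟨i, g, hi2, rfl⟩))
      · have hi2 : i < 2 * m := by
          rcases Nat.lt_or_ge i (2 * m) with g | g
          · exact g
          · exfalso
            apply hnot
            rw [show i = 2 * m by omega, hb.2.2.1, hbm, hb0]
            exact Or.inr rfl
        rcases Nat.lt_or_ge i q with g | g
        · exact Or.inr (Or.inl ⟨i, g, rfl⟩)
        · exact Or.inl (Or.inr (Or.inr ⟨i, g, hi2, rfl⟩))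
      · exact Or.inl (Or.inr (Or.inl rfl))
      · exact Or.inr (Or.inr (Or.inl rfl))

end
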